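/- arXiv:2407.06155 — 4 statements merged into one kernel-verified Lean document; each statement's English description precedes it below -/
import Mathlib

section
/- Let G be a graph on vertex set {1,…,n} and write X_G(x) = Σ_λ c_λ e_λ for the expansion of its chromatic symmetric function in the basis of elementary symmetric functions. If c_λ ≠ 0, then the independence number of G satisfies α(G) ≥ λ'_1 (the number of parts of λ) and the clique number of G satisfies ω(G) ≤ λ_1 (the largest part of λ). -/
open Finset MvPolynomial
open scoped Classical

noncomputable section

/-- `κ` is a proper colouring of `G`. -/
def IsProper {n N : ℕ} (G : SimpleGraph (Fin n)) (κ : Fin n → Fin N) : Prop :=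
  ∀ i j, G.Adj i j → κ i ≠ κ j

/-- The chromatic symmetric function of `G`, truncated to `N` variables. -/
def chromSym (n N : ℕ) (G : SimpleGraph (Fin n)) : MvPolynomial (Fin N) ℤ :=
  ∑ κ : Fin n → Fin N, if IsProper G κ then ∏ i, X (κ i) else 0

/-- The number of ascents of a colouring. -/
def ascNum {n N : ℕ} (G : SimpleGraph (Fin n)) (κ : Fin n → Fin N) : ℕ :=
  ((Finset.univ : Finset (Fin n × Fin n)).filter fun p =>
    G.Adj p.1 p.2 ∧ p.1 < p.2 ∧ κ p.1 < κ p.2).card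

/-- The chromatic quasisymmetric function of `G`, with coefficients in `ℤ[q]`,
truncated to `N` variables. -/
def chromQSym (n N : ℕ) (G : SimpleGraph (Fin n)) :
    MvPolynomial (Fin N) (Polynomial ℤ) :=
  ∑ κ : Fin n → Fin N, if IsProper G κ then
    C (Polynomial.X ^ ascNum G κ) * ∏ i, X (κ i) else 0

/-- `e_λ`, the product of elementary symmetric polynomials over the parts of `λ`. -/
def eProd (N : ℕ) (R : Type) [CommSemiring R] {n : ℕ} (p : Nat.Partition n) :
    MvPolynomial (Fin N) R :=
  (p.parts.map fun k => esymm (Fin N) R k).prod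

/-- The number of parts of a partition, i.e. `λ'_1`. -/
def numParts {n : ℕ} (p : Nat.Partition n) : ℕ := Multiset.card p.parts

/-- The largest part `λ_1` of a partition. -/
def maxPart {n : ℕ} (p : Nat.Partition n) : ℕ := p.parts.sup

/-- `λ'_1 + ⋯ + λ'_k`, the number of cells in the first `k` columns of `λ`. -/
def conjSum {n : ℕ} (p : Nat.Partition n) (k : ℕ) : ℕ :=
  (p.parts.map fun a => min a k).sum

/-- `λ_1 + ⋯ + λ_k`, the number of cells in the first `k` rows of `λ`. -/
def partSum {n : ℕ} (p : Nat.Partition n) (k : ℕ) : ℕ :=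
  ∑ j ∈ Finset.Icc 1 n, min (Multiset.card (p.parts.filter fun a => j ≤ a)) k

/-- `s` is an independent set of vertices of `G`. -/
def IsIndepFinset {V : Type} (G : SimpleGraph V) (s : Finset V) : Prop :=
  ∀ i ∈ s, ∀ j ∈ s, ¬ G.Adj i j

/-- `s` is a clique of `G`. -/
def IsCliqueFinset {V : Type} (G : SimpleGraph V) (s : Finset V) : Prop :=
  ∀ i ∈ s, ∀ j ∈ s, i ≠ j → G.Adj i j

/-- The independence number `α(G)`. -/
def indepNum {n : ℕ} (G : SimpleGraph (Fin n)) : ℕ :=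
  sSup {k | ∃ s : Finset (Fin n), IsIndepFinset G s ∧ s.card = k}

/-- The clique number `ω(G)`. -/
def cliqueNum {n : ℕ} (G : SimpleGraph (Fin n)) : ℕ :=
  sSup {k | ∃ s : Finset (Fin n), IsCliqueFinset G s ∧ s.card = k}

/-- `α_k(G)`: the maximum number of vertices in an independent partition
with `k` blocks. -/
def alphaK {n : ℕ} (G : SimpleGraph (Fin n)) (k : ℕ) : ℕ :=
  sSup {m | ∃ B : Fin k → Finset (Fin n),
    (∀ i j, i ≠ j → Disjoint (B i) (B j)) ∧
    (∀ i, IsIndepFinset G (B i)) ∧ m = ∑ i, (B i).card}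

/-- `ω_k(G)`: the maximum number of vertices in a clique partition
with `k` blocks. -/
def omegaK {n : ℕ} (G : SimpleGraph (Fin n)) (k : ℕ) : ℕ :=
  sSup {m | ∃ B : Fin k → Finset (Fin n),
    (∀ i j, i ≠ j → Disjoint (B i) (B j)) ∧
    (∀ i, IsCliqueFinset G (B i)) ∧ m = ∑ i, (B i).card}

/-- `G` is a natural unit interval graph. -/
def IsNUIG {n : ℕ} (G : SimpleGraph (Fin n)) : Prop :=
  ∀ i j k : Fin n, i < j → j < k → G.Adj i k → G.Adj i j ∧ G.Adj j k

/-- The `q`-integer `[k]_q = 1 + q + ⋯ + q^(k-1)` in `ℤ[q]`. -/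
def qInt (k : ℕ) : Polynomial ℤ := ∑ i ∈ Finset.range k, Polynomial.X ^ i

/-- The `q`-factorial `[k]_q!` in `ℤ[q]`. -/
def qFact : ℕ → Polynomial ℤ
  | 0 => 1
  | k + 1 => qInt (k + 1) * qFact k

end

section AlphaOmegaProof

open AddMonoidAlgebra

/-- Multiplicities of the parts of a partition, as an exponent vector. -/
noncomputable def cntVec (N : ℕ) {n : ℕ} (p : Nat.Partition n) : Fin N →₀ ℕ :=
  Finsupp.equivFunOnFinite.symm fun i => p.parts.count (i.val + 1)

lemma cntVec_apply (N : ℕ) {n : ℕ} (p : Nat.Partition n) (i : Fin N) :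
    cntVec N p i = p.parts.count (i.val + 1) := rfl

lemma part_le {n : ℕ} (p : Nat.Partition n) {m : ℕ} (hm : m ∈ p.parts) : m ≤ n := by
  have := Multiset.le_sum_of_mem hm
  rwa [p.parts_sum] at this

lemma prod_count {M : Type*} [CommMonoid M] {n N : ℕ} (hN : n ≤ N) (p : Nat.Partition n)
    (g : ℕ → ℕ → M) (hg : ∀ m, g m 0 = 1) :
    ∏ i : Fin N, g (i.val + 1) (p.parts.count (i.val + 1)) =
      ∏ m ∈ p.parts.toFinset, g m (p.parts.count m) := by
  rw [Finset.prod_range (fun i => g (i + 1) (p.parts.count (i + 1))) |>.symm,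
    Finset.range_eq_Ico, Finset.prod_Ico_add' (fun i => g i (p.parts.count i)) 0 N 1]
  symm
  apply Finset.prod_subset
  · intro m hm
    rw [Multiset.mem_toFinset] at hm
    have h1 := part_le p hm
    have h2 := p.parts_pos hm
    rw [Finset.mem_Ico]; omega
  · intro m _ hm
    rw [Multiset.mem_toFinset] at hm
    rw [Multiset.count_eq_zero_of_notMem hm, hg]

lemma eProd_eq {n N : ℕ} (hN : n ≤ N) (p : Nat.Partition n) :
    eProd N ℤ p = esymmAlgHomMonomial (Fin N) (cntVec N p) 1 := by
  rw [esymmAlgHomMonomial, esymmAlgHom_apply, aeval_monomial, map_one, one_mul,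
    Finsupp.prod_fintype _ _ (fun i => pow_zero _)]
  simp only [cntVec_apply]
  rw [prod_count hN p (fun m k => esymm (Fin N) ℤ m ^ k) (fun m => pow_zero _), eProd,
    Finset.prod_multiset_map_count]

/-- The lex-leading exponent of `e_λ`. -/
noncomputable def lexDeg (N : ℕ) {n : ℕ} (p : Nat.Partition n) : Lex (Fin N →₀ ℕ) :=
  supDegree toLex (eProd N ℤ p)

lemma lexDeg_apply {n N : ℕ} (hN : n ≤ N) (p : Nat.Partition n) :
    ⇑(ofLex (lexDeg N p)) = Fin.accumulate N N (cntVec N p) := by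
  rw [lexDeg, eProd_eq hN, supDegree_esymmAlgHomMonomial one_ne_zero _ le_rfl]

lemma lexDeg_inj {n N : ℕ} (hN : n ≤ N) {p q : Nat.Partition n} (h : lexDeg N p = lexDeg N q) :
    p = q := by
  have h1 : Fin.accumulate N N (cntVec N p) = Fin.accumulate N N (cntVec N q) := by
    rw [← lexDeg_apply hN, ← lexDeg_apply hN, h]
  have h2 := Fin.accumulate_injective le_rfl h1
  ext m
  by_cases hm : 1 ≤ m ∧ m ≤ N
  · have h3 := congrFun h2 ⟨m - 1, by omega⟩
    simp only [cntVec_apply] at h3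
    rwa [Nat.sub_add_cancel hm.1] at h3
  · have key : ∀ r : Nat.Partition n, r.parts.count m = 0 := by
      intro r
      apply Multiset.count_eq_zero_of_notMem
      intro hr
      have h1 := part_le r hr
      have h2 := r.parts_pos hr
      omega
    rw [key, key]

lemma coeff_lexDeg {n N : ℕ} (hN : n ≤ N) (p : Nat.Partition n) :
    MvPolynomial.coeff (ofLex (lexDeg N p)) (eProd N ℤ p) = 1 := by
  have h := leadingCoeff_esymmAlgHomMonomial (r := (1 : ℤ)) (cntVec N p) (le_refl N)
  rw [← eProd_eq hN, AddMonoidAlgebra.leadingCoeff] at h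
  have h2 : Function.invFun (toLex : (Fin N →₀ ℕ) → Lex (Fin N →₀ ℕ)) (lexDeg N p)
      = ofLex (lexDeg N p) := Function.leftInverse_invFun toLex.injective (ofLex (lexDeg N p))
  rw [← h2]
  exact h

lemma coeff_eq_zero_of_lt {n N : ℕ} (p : Nat.Partition n) (d : Lex (Fin N →₀ ℕ))
    (h : lexDeg N p < d) : MvPolynomial.coeff (ofLex d) (eProd N ℤ p) = 0 :=
  coeff_eq_zero_of_not_le_supDegree (D := toLex) (p := eProd N ℤ p) (a := ofLex d)
    (not_le.2 h)

lemma coeff_eq_zero_of_part {n N : ℕ} (p : Nat.Partition n) (d : Fin N →₀ ℕ) (k m : ℕ)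
    (hm : m ∈ p.parts) (hk : k < m) (hd : ∀ j : Fin N, k ≤ j.val → d j = 0) :
    MvPolynomial.coeff d (eProd N ℤ p) = 0 := by
  by_contra hne
  have h1 : d ∈ (eProd N ℤ p).support := MvPolynomial.mem_support_iff.2 hne
  rw [eProd, ← Multiset.cons_erase hm, Multiset.map_cons, Multiset.prod_cons] at h1
  obtain ⟨a, ha, b, hb, hab⟩ := Finset.mem_add.1 (MvPolynomial.support_mul _ _ h1)
  rw [support_esymm, Finset.mem_image] at ha
  obtain ⟨t, ht, rfl⟩ := ha
  rw [Finset.mem_powersetCard] at ht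
  have h2 : ∀ i ∈ t, i.val < k := by
    intro i hi
    by_contra hik
    have h3 := hd i (not_lt.1 hik)
    rw [← hab, Finsupp.add_apply, Finsupp.finsetSum_apply] at h3
    have h4 := (Nat.add_eq_zero_iff.1 h3).1
    have h5 := (Finset.sum_eq_zero_iff.1 h4) i hi
    simp at h5
  have h3 : t.card ≤ (Finset.range k).card :=
    Finset.card_le_card_of_injOn (fun i => i.val) (fun i hi => by simpa using h2 i hi)
      (fun i _ j _ h => Fin.ext h)
  rw [Finset.card_range, ht.2] at h3
  omega

lemma lexDeg_eq_zero {n N : ℕ} (hN : n ≤ N) (p : Nat.Partition n) (j : Fin N)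
    (hj : maxPart p ≤ j.val) : ofLex (lexDeg N p) j = 0 := by
  rw [lexDeg_apply hN, Fin.accumulate_apply]
  apply Finset.sum_eq_zero
  intro i hi
  rw [cntVec_apply]
  apply Multiset.count_eq_zero_of_notMem
  intro h
  have h1 : i.val + 1 ≤ maxPart p := Multiset.le_sup h
  have h2 := (Finset.mem_filter.1 hi).2
  omega

lemma lexDeg_first {n N : ℕ} (hN : n ≤ N) (p : Nat.Partition n) (h0 : 0 < N) :
    ofLex (lexDeg N p) ⟨0, h0⟩ = numParts p := by
  rw [lexDeg_apply hN, Fin.accumulate_apply]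
  simp only [Nat.zero_le, Finset.filter_true, cntVec_apply]
  have := prod_count (M := Multiplicative ℕ) hN p (fun _ k => Multiplicative.ofAdd k)
    (fun _ => rfl)
  have h2 : ∑ i : Fin N, p.parts.count (i.val + 1) = ∑ m ∈ p.parts.toFinset, p.parts.count m :=
    this
  rw [h2, numParts, Multiset.toFinset_sum_count_eq]

lemma lex_first_le {N : ℕ} (h0 : 0 < N) {a b : Lex (Fin N →₀ ℕ)} (h : a ≤ b) :
    ofLex a ⟨0, h0⟩ ≤ ofLex b ⟨0, h0⟩ := by
  rcases h.eq_or_lt with rfl | h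
  · exact le_rfl
  · obtain ⟨i, hi, hlt⟩ := Finsupp.Lex.lt_iff.1 h
    rcases Nat.eq_zero_or_pos i.val with hz | hz
    · have : i = ⟨0, h0⟩ := Fin.ext hz
      rw [← this]; exact hlt.le
    · exact (hi ⟨0, h0⟩ hz).le

lemma exists_colouring {n N : ℕ} (G : SimpleGraph (Fin n)) (d : Fin N →₀ ℕ)
    (h : MvPolynomial.coeff d (chromSym n N G) ≠ 0) :
    ∃ κ : Fin n → Fin N, IsProper G κ ∧
      ∀ j, d j = (Finset.univ.filter fun i => κ i = j).card := by
  rw [chromSym, MvPolynomial.coeff_sum] at h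
  obtain ⟨κ, -, hκ⟩ := Finset.exists_ne_zero_of_sum_ne_zero h
  by_cases hp : IsProper G κ
  · refine ⟨κ, hp, ?_⟩
    rw [if_pos hp] at hκ
    have h1 : (∏ i, X (κ i) : MvPolynomial (Fin N) ℤ) =
        monomial (∑ i, Finsupp.single (κ i) 1) 1 := by
      rw [MvPolynomial.monomial_sum_one]; rfl
    rw [h1, MvPolynomial.coeff_monomial] at hκ
    have h2 : ∑ i, Finsupp.single (κ i) 1 = d := by
      by_contra h3
      exact hκ (if_neg h3)
    intro j
    rw [← h2, Finsupp.finsetSum_apply, Finset.card_filter]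
    exact Finset.sum_congr rfl fun i _ => by rw [Finsupp.single_apply]
  · rw [if_neg hp, MvPolynomial.coeff_zero] at hκ
    exact absurd rfl hκ

lemma main_exists {n N : ℕ} (hN : n ≤ N) (G : SimpleGraph (Fin n))
    (c : Nat.Partition n → ℤ)
    (hc : chromSym n N G = ∑ p : Nat.Partition n, C (c p) * eProd N ℤ p)
    (p : Nat.Partition n) (hp : c p ≠ 0) :
    ∃ q : Nat.Partition n, maxPart q ≤ maxPart p ∧ lexDeg N p ≤ lexDeg N q ∧
      MvPolynomial.coeff (ofLex (lexDeg N q)) (chromSym n N G) ≠ 0 := by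
  obtain ⟨q, hq, hmax⟩ := Finset.exists_max_image
    (Finset.univ.filter fun q : Nat.Partition n => c q ≠ 0 ∧ maxPart q ≤ maxPart p)
    (lexDeg N) ⟨p, by simp [hp]⟩
  have hq' := (Finset.mem_filter.1 hq).2
  refine ⟨q, hq'.2, hmax p (by simp [hp]), ?_⟩
  rw [hc, MvPolynomial.coeff_sum, Finset.sum_eq_single q]
  · rw [MvPolynomial.coeff_C_mul, coeff_lexDeg hN, mul_one]
    exact hq'.1
  · intro r _ hr
    rw [MvPolynomial.coeff_C_mul]
    by_cases hcr : c r = 0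
    · rw [hcr, zero_mul]
    by_cases hmr : maxPart r ≤ maxPart p
    · have h1 := hmax r (by simp [hcr, hmr])
      rw [coeff_eq_zero_of_lt r _ (h1.lt_of_ne fun h => hr (lexDeg_inj hN h)), mul_zero]
    · have h2 : ∃ m ∈ r.parts, maxPart p < m := by
        by_contra! h3
        exact hmr (Multiset.sup_le.2 h3)
      obtain ⟨m, hm, hlt⟩ := h2
      rw [coeff_eq_zero_of_part r _ (maxPart p) m hm hlt
        (fun j hj => lexDeg_eq_zero hN q j (hq'.2.trans hj)), mul_zero]
  · intro h; exact absurd (Finset.mem_univ _) h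

end AlphaOmegaProof

/-- Alpha-Omega Lemma, chromatic symmetric function version.
If `c_λ ≠ 0` in the `e`-expansion of `X_G`, then `α(G) ≥ λ'_1` and `ω(G) ≤ λ_1`. -/
theorem stmt0 (n N : ℕ) (hN : n ≤ N) (G : SimpleGraph (Fin n))
    (c : Nat.Partition n → ℤ)
    (hc : chromSym n N G = ∑ p : Nat.Partition n, C (c p) * eProd N ℤ p)
    (p : Nat.Partition n) (hp : c p ≠ 0) :
    numParts p ≤ indepNum G ∧ cliqueNum G ≤ maxPart p := by
  obtain ⟨q, hqp, hlex, hcoef⟩ := main_exists hN G c hc p hp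
  obtain ⟨κ, hκ, hd⟩ := exists_colouring G _ hcoef
  constructor
  · rcases Nat.eq_zero_or_pos (numParts p) with h | h
    · omega
    · obtain ⟨m, hm⟩ := Multiset.card_pos_iff_exists_mem.1 h
      have h0 : 0 < N := by
        have h1 := part_le p hm
        have h2 := p.parts_pos hm
        omega
      have h1 := lex_first_le h0 hlex
      rw [lexDeg_first hN p h0, hd] at h1
      refine h1.trans (le_csSup ⟨n, ?_⟩ ⟨_, ?_, rfl⟩)
      · rintro k ⟨s, -, rfl⟩
        simpa using Finset.card_le_univ s
      · intro i hi j hj hij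
        exact hκ i j hij ((Finset.mem_filter.1 hi).2.trans (Finset.mem_filter.1 hj).2.symm)
  · refine csSup_le ⟨0, ∅, fun i hi => absurd hi (Finset.notMem_empty i), rfl⟩ ?_
    rintro k ⟨s, hs, rfl⟩
    have h1 : s.card ≤ (Finset.range (maxPart p)).card := by
      refine Finset.card_le_card_of_injOn (fun i => (κ i).val) ?_ ?_
      · intro i _
        rw [Finset.coe_range, Set.mem_Iio]
        by_contra hge
        have h2 := lexDeg_eq_zero hN q (κ i) (hqp.trans (not_lt.1 hge))
        rw [hd, Finset.card_eq_zero] at h2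
        have h3 : i ∈ Finset.univ.filter fun i' => κ i' = κ i := by simp
        rw [h2] at h3
        exact absurd h3 (Finset.notMem_empty i)
      · intro i hi j hj hij
        by_contra hne
        exact hκ i j (hs i hi j hj hne) (Fin.ext hij)
    rwa [Finset.card_range] at h1
end

section
/- Let G be a graph on vertex set {1,…,n} whose chromatic quasisymmetric function X_G(x;q) is symmetric in the x variables, and write X_G(x;q) = Σ_λ c_λ(q) e_λ with c_λ(q) ∈ ℤ[q]. If c_λ(q) ≠ 0, then the independence number of G satisfies α(G) ≥ λ'_1 (the number of parts of λ) and the clique number of G satisfies ω(G) ≤ λ_1 (the largest part of λ). -/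
open Finset MvPolynomial
open scoped Classical

theorem esymm_indep {n m : ℕ} (S : Finset (Nat.Partition n)) (f : Nat.Partition n → Multiset ℕ)
    (hle : ∀ q ∈ S, ∀ k ∈ f q, k ≤ m)
    (hinj : ∀ q ∈ S, ∀ r ∈ S, (∀ k, 1 ≤ k → (f q).count k = (f r).count k) → q = r)
    (c : Nat.Partition n → Polynomial ℤ)
    (h : ∑ q ∈ S, C (c q) * ((f q).map (esymm (Fin m) (Polynomial ℤ))).prod = 0) :
    ∀ q ∈ S, c q = 0 := by
  let d : Nat.Partition n → (Fin m →₀ ℕ) := fun q =>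
    Finsupp.equivFunOnFinite.symm fun j => (f q).count (j.1 + 1)
  have hd : ∀ q j, d q j = (f q).count (j.1 + 1) := fun q j => rfl
  have hprod : ∀ q ∈ S, ((f q).map (esymm (Fin m) (Polynomial ℤ))).prod =
      ∏ j : Fin m, esymm (Fin m) (Polynomial ℤ) (j.1 + 1) ^ d q j := by
    intro q hq
    have hsub : (f q).toFinset ⊆ Finset.range (m + 1) := by
      intro k hk
      have := hle q hq k (by simpa using hk)
      simp; omega
    rw [Finset.prod_multiset_map_count, Finset.prod_subset hsub]
    · rw [Finset.prod_range_succ', esymm_zero, one_pow, mul_one]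
      rw [← Fin.prod_univ_eq_prod_range
        (fun k => esymm (Fin m) (Polynomial ℤ) (k + 1) ^ (f q).count (k + 1))]
      rfl
    · intro k _ hk
      rw [Multiset.count_eq_zero_of_notMem (by simpa using hk), pow_zero]
  have hdinj : ∀ q ∈ S, ∀ r ∈ S, d q = d r → q = r := by
    intro q hq r hr hqr
    apply hinj q hq r hr
    intro k hk
    by_cases hkm : k ≤ m
    · have := DFunLike.congr_fun hqr ⟨k - 1, by omega⟩
      rw [hd, hd] at this
      simpa [Nat.sub_add_cancel hk] using this
    · rw [Multiset.count_eq_zero_of_notMem fun h => hkm (hle q hq k h),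
        Multiset.count_eq_zero_of_notMem fun h => hkm (hle r hr k h)]
  have hz : ∑ q ∈ S, monomial (d q) (c q) = 0 := by
    apply esymmAlgHom_fin_injective (Polynomial ℤ) (le_refl m)
    rw [map_zero]
    apply Subtype.ext
    rw [esymmAlgHom_apply, map_sum]
    rw [ZeroMemClass.coe_zero, ← h]
    apply Finset.sum_congr rfl
    intro q hq
    rw [aeval_monomial, hprod q hq, Finsupp.prod_fintype _ _ (by simp)]
    rfl
  intro q hq
  have := congrArg (coeff (d q)) hz
  rw [coeff_sum, Finset.sum_eq_single q] at this
  · simpa using this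
  · intro r hr hrq
    rw [coeff_monomial, if_neg fun h => hrq (hdinj r hr q hq h)]
  · exact fun h => absurd hq h

theorem finSuccEquiv_C_apply (M : ℕ) (a : Polynomial ℤ) :
    finSuccEquiv (Polynomial ℤ) M (C a) = Polynomial.C (C a) := by
  simp [finSuccEquiv_apply]

theorem finSucc_esymm (M k : ℕ) :
    finSuccEquiv (Polynomial ℤ) M (esymm (Fin (M + 1)) (Polynomial ℤ) (k + 1)) =
      Polynomial.C (esymm (Fin M) (Polynomial ℤ) (k + 1)) +
        Polynomial.X * Polynomial.C (esymm (Fin M) (Polynomial ℤ) k) := by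
  have hC : ∀ k, Polynomial.C (esymm (Fin M) (Polynomial ℤ) k) =
      ((univ : Finset (Fin M)).val.map fun i =>
        (Polynomial.C (X i : MvPolynomial (Fin M) (Polynomial ℤ)))).esymm k := by
    intro k
    rw [Finset.esymm_map_val, esymm, map_sum]
    simp [map_prod]
  have hL : finSuccEquiv (Polynomial ℤ) M (esymm (Fin (M + 1)) (Polynomial ℤ) (k + 1)) =
      ((univ : Finset (Fin (M + 1))).val.map fun i =>
        finSuccEquiv (Polynomial ℤ) M (X i)).esymm (k + 1) := by
    rw [Finset.esymm_map_val, esymm, map_sum]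
    simp [map_prod]
  rw [hL, hC, hC, Fin.univ_succ, Finset.cons_val, Multiset.map_cons, Finset.map_val,
    Multiset.map_map, finSuccEquiv_X_zero]
  simp only [Multiset.esymm, Multiset.powersetCard_cons, Multiset.map_add, Multiset.sum_add,
    Multiset.map_map, Function.comp_def, Multiset.prod_cons, Multiset.sum_map_mul_left,
    Function.Embedding.coeFn_mk, finSuccEquiv_X_succ]

theorem killCompl_esymm {m N : ℕ} (h : m ≤ N) (k : ℕ) :
    killCompl (R := Polynomial ℤ) (Fin.castLE_injective h) (esymm (Fin N) (Polynomial ℤ) k) =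
      esymm (Fin m) (Polynomial ℤ) k := by
  have hsub : powersetCard k ((univ : Finset (Fin m)).map (Fin.castLEEmb h)) ⊆
      powersetCard k univ := powersetCard_mono (subset_univ _)
  rw [esymm, map_sum, ← Finset.sum_subset hsub]
  · rw [powersetCard_map, Finset.sum_map, esymm]
    apply Finset.sum_congr rfl
    intro t _
    rw [map_prod, RelEmbedding.coe_toEmbedding, mapEmbedding_apply, Finset.prod_map]
    apply Finset.prod_congr rfl
    intro i _
    have := killCompl_rename_app (R := Polynomial ℤ) (Fin.castLE_injective h) (X i)
    simpa using this
  · intro t ht hnt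
    have : ∃ i ∈ t, i ∉ Set.range (Fin.castLE h) := by
      by_contra hcon
      push Not at hcon
      apply hnt
      rw [mem_powersetCard] at ht ⊢
      refine ⟨fun i hi => ?_, ht.2⟩
      obtain ⟨j, rfl⟩ := hcon i hi
      simp
    obtain ⟨i, hi, hin⟩ := this
    rw [map_prod]
    apply Finset.prod_eq_zero hi
    simp only [killCompl, aeval_X]
    rw [dif_neg hin]

theorem le_indepNum {n : ℕ} {G : SimpleGraph (Fin n)} {s : Finset (Fin n)}
    (hs : IsIndepFinset G s) : s.card ≤ indepNum G := by
  apply le_csSup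
  · refine ⟨n, ?_⟩
    rintro k ⟨t, _, rfl⟩
    simpa using t.card_le_univ
  · exact ⟨s, hs, rfl⟩

theorem exists_clique {n : ℕ} (G : SimpleGraph (Fin n)) :
    ∃ s : Finset (Fin n), IsCliqueFinset G s ∧ s.card = cliqueNum G := by
  apply Nat.sSup_mem (s := {k | ∃ s : Finset (Fin n), IsCliqueFinset G s ∧ s.card = k})
  · exact ⟨0, ∅, by intro i hi; simp at hi, rfl⟩
  · refine ⟨n, ?_⟩
    rintro k ⟨t, _, rfl⟩
    simpa using t.card_le_univ

theorem omega_part (n N : ℕ) (hN : n ≤ N) (G : SimpleGraph (Fin n))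
    (c : Nat.Partition n → Polynomial ℤ)
    (hc : chromQSym n N G = ∑ p : Nat.Partition n, C (c p) * eProd N (Polynomial ℤ) p)
    (p : Nat.Partition n) (hp : c p ≠ 0) : cliqueNum G ≤ maxPart p := by
  by_contra hlt
  push Not at hlt
  obtain ⟨s, hs, hcard⟩ := exists_clique G
  have hsn : s.card ≤ n := by simpa using s.card_le_univ
  obtain ⟨m, hm⟩ : ∃ m, cliqueNum G = m + 1 := ⟨cliqueNum G - 1, by omega⟩
  have hmN : m ≤ N := by omega
  have h := congrArg (killCompl (R := Polynomial ℤ) (Fin.castLE_injective hmN)) hc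
  have h0 : killCompl (R := Polynomial ℤ) (Fin.castLE_injective hmN) (chromQSym n N G) = 0 := by
    rw [chromQSym, map_sum]
    apply Finset.sum_eq_zero
    intro κ _
    split_ifs with hκ
    · have : ∃ i, κ i ∉ Set.range (Fin.castLE hmN) := by
        by_contra hcon
        push Not at hcon
        choose g hg using hcon
        have hc2 : (univ : Finset (Fin m)).card < s.card := by simp; omega
        obtain ⟨x, hx, y, hy, hxy, hgxy⟩ :=
          Finset.exists_ne_map_eq_of_card_lt_of_maps_to hc2 (f := g) (fun _ _ => by simp)
        exact hκ x y (hs x hx y hy hxy) (by rw [← hg x, ← hg y, hgxy])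
      obtain ⟨i, hi⟩ := this
      rw [map_mul, map_prod, Finset.prod_eq_zero (mem_univ i), mul_zero]
      simp only [killCompl, aeval_X]
      rw [dif_neg hi]
    · simp
  rw [h0, map_sum] at h
  have hterm : ∀ q : Nat.Partition n,
      killCompl (R := Polynomial ℤ) (Fin.castLE_injective hmN)
        (C (c q) * eProd N (Polynomial ℤ) q) =
      C (c q) * (q.parts.map (esymm (Fin m) (Polynomial ℤ))).prod := by
    intro q
    rw [map_mul, killCompl_C, eProd, map_multiset_prod, Multiset.map_map]
    simp only [Function.comp_def, killCompl_esymm]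
  simp only [hterm] at h
  refine hp (esymm_indep (m := m) (univ.filter fun q : Nat.Partition n => ∀ k ∈ q.parts, k ≤ m)
    (fun q => q.parts) (by intro q hq; simpa using hq) ?_ c ?_ p ?_)
  · intro q _ r _ hqr
    apply Nat.Partition.ext
    ext k
    rcases Nat.eq_zero_or_pos k with rfl | hk
    · rw [Multiset.count_eq_zero_of_notMem fun h => absurd (q.parts_pos h) (lt_irrefl _),
        Multiset.count_eq_zero_of_notMem fun h => absurd (r.parts_pos h) (lt_irrefl _)]
    · exact hqr k hk
  · rw [h]
    apply Finset.sum_subset (subset_univ _)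
    intro q _ hq
    simp only [mem_filter, mem_univ, true_and, not_forall] at hq
    obtain ⟨k, hk, hkm⟩ := hq
    have : esymm (Fin m) (Polynomial ℤ) k = 0 := by
      rw [esymm, powersetCard_eq_empty.2 (by simp; omega), Finset.sum_empty]
    rw [Multiset.prod_eq_zero, mul_zero]
    rw [← this]
    exact Multiset.mem_map_of_mem _ hk
  · simp only [mem_filter, mem_univ, true_and]
    intro k hk
    have : k ≤ maxPart p := Multiset.le_sup hk
    omega

theorem coeff_finSucc_eProd {n M : ℕ} (q : Nat.Partition n) :
    (finSuccEquiv (Polynomial ℤ) M (eProd (M + 1) (Polynomial ℤ) q)).natDegree ≤ numParts q ∧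
    (finSuccEquiv (Polynomial ℤ) M (eProd (M + 1) (Polynomial ℤ) q)).coeff (numParts q) =
      ((q.parts.map (fun k => k - 1)).map (esymm (Fin M) (Polynomial ℤ))).prod := by
  have hpos : ∀ k ∈ q.parts, 0 < k := fun k hk => q.parts_pos hk
  rw [eProd, numParts]
  generalize q.parts = t at hpos
  induction t using Multiset.induction_on with
  | empty => simp
  | cons k t ih =>
    obtain ⟨h1, h2⟩ := ih fun j hj => hpos j (Multiset.mem_cons_of_mem hj)
    obtain ⟨k, rfl⟩ : ∃ j, k = j + 1 := ⟨k - 1, by have := hpos k (by simp); omega⟩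
    have hdeg : (finSuccEquiv (Polynomial ℤ) M
        (esymm (Fin (M + 1)) (Polynomial ℤ) (k + 1))).natDegree ≤ 1 := by
      rw [finSucc_esymm]
      compute_degree
    simp only [Multiset.map_cons, Multiset.prod_cons, map_mul, Multiset.card_cons]
    constructor
    · refine Polynomial.natDegree_mul_le.trans ?_
      omega
    · rw [add_comm t.card 1, Polynomial.coeff_mul_add_eq_of_natDegree_le hdeg h1, h2, finSucc_esymm]
      simp [Polynomial.coeff_C]

theorem alpha_part (n N : ℕ) (hN : n ≤ N) (G : SimpleGraph (Fin n))
    (c : Nat.Partition n → Polynomial ℤ)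
    (hc : chromQSym n N G = ∑ p : Nat.Partition n, C (c p) * eProd N (Polynomial ℤ) p)
    (p : Nat.Partition n) (hp : c p ≠ 0) : numParts p ≤ indepNum G := by
  have hpn : ∀ q : Nat.Partition n, ∀ k ∈ q.parts, k ≤ n := fun q k hk => by
    have := Multiset.le_sum_of_mem hk
    rwa [q.parts_sum] at this
  rcases Nat.eq_zero_or_pos n with rfl | hn
  · have : p.parts = 0 := by
      apply Multiset.eq_zero_of_forall_notMem
      intro k hk
      have := hpn p k hk
      have := p.parts_pos hk
      omega
    simp [numParts, this]
  obtain ⟨M, rfl⟩ : ∃ M, N = M + 1 := ⟨N - 1, by omega⟩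
  by_contra hlt
  push Not at hlt
  obtain ⟨p₀, hp₀, hmax⟩ := Finset.exists_max_image
    (univ.filter fun q : Nat.Partition n => c q ≠ 0) numParts ⟨p, by simpa using hp⟩
  simp only [mem_filter, mem_univ, true_and] at hp₀ hmax
  have hL : indepNum G < numParts p₀ := lt_of_lt_of_le hlt (hmax p hp)
  have h := congrArg (fun f => (finSuccEquiv (Polynomial ℤ) M f).coeff (numParts p₀)) hc
  simp only [map_sum, Polynomial.finsetSum_coeff] at h
  have h0 : (finSuccEquiv (Polynomial ℤ) M (chromQSym n (M + 1) G)).coeff (numParts p₀) = 0 := by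
    rw [chromQSym, map_sum, Polynomial.finsetSum_coeff]
    apply Finset.sum_eq_zero
    intro κ _
    split_ifs with hκ
    · apply Polynomial.coeff_eq_zero_of_natDegree_lt
      refine lt_of_le_of_lt ?_ hL
      have hind : IsIndepFinset G (univ.filter fun i => κ i = 0) := by
        intro i hi j hj hij
        simp only [mem_filter, mem_univ, true_and] at hi hj
        exact hκ i j hij (hi.trans hj.symm)
      refine le_trans ?_ (le_indepNum hind)
      rw [map_mul, finSuccEquiv_C_apply, map_prod]
      refine (Polynomial.natDegree_C_mul_le _ _).trans ?_
      refine (Polynomial.natDegree_prod_le _ _).trans ?_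
      rw [Finset.card_filter]
      apply Finset.sum_le_sum
      intro i _
      rcases Fin.eq_zero_or_eq_succ (κ i) with h | ⟨j, h⟩
      · rw [h, finSuccEquiv_X_zero]; simp
      · rw [h, finSuccEquiv_X_succ]; simp
    · simp
  rw [h0] at h
  have hterm : ∀ q : Nat.Partition n, numParts q ≤ numParts p₀ →
      (finSuccEquiv (Polynomial ℤ) M (C (c q) * eProd (M + 1) (Polynomial ℤ) q)).coeff
        (numParts p₀) = if numParts q = numParts p₀ then C (c q) *
          ((q.parts.map (fun k => k - 1)).map (esymm (Fin M) (Polynomial ℤ))).prod else 0 := by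
    intro q hq
    obtain ⟨h1, h2⟩ := coeff_finSucc_eProd (M := M) q
    rw [map_mul, finSuccEquiv_C_apply, Polynomial.coeff_C_mul]
    split_ifs with he
    · rw [← he, h2]
    · rw [Polynomial.coeff_eq_zero_of_natDegree_lt (by omega), mul_zero]
  refine hp₀ (esymm_indep (m := M)
    (univ.filter fun q : Nat.Partition n => numParts q = numParts p₀)
    (fun q => q.parts.map (fun k => k - 1)) ?_ ?_ c ?_ p₀ (by simp))
  · intro q _ k hk
    obtain ⟨j, hj, rfl⟩ := Multiset.mem_map.1 hk
    have := hpn q j hj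
    omega
  · intro q hq r hr hqr
    simp only [mem_filter, mem_univ, true_and] at hq hr
    have hsucc : ∀ (u : Nat.Partition n) k, 1 ≤ k →
        (u.parts.map (fun k => k - 1)).count k = u.parts.count (k + 1) := by
      intro u k hk
      rw [Multiset.count_map, ← Multiset.countP_eq_card_filter, Multiset.count]
      apply Multiset.countP_congr rfl
      intro x _
      simp only [eq_iff_iff]
      omega
    have hge : ∀ k, k ≠ 1 → q.parts.count k = r.parts.count k := by
      intro k hk
      rcases Nat.eq_zero_or_pos k with rfl | hk0
      · rw [Multiset.count_eq_zero_of_notMem fun h => absurd (q.parts_pos h) (lt_irrefl _),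
          Multiset.count_eq_zero_of_notMem fun h => absurd (r.parts_pos h) (lt_irrefl _)]
      · obtain ⟨j, rfl⟩ : ∃ j, k = j + 1 := ⟨k - 1, by omega⟩
        have := hqr j (by omega)
        rwa [hsucc q j (by omega), hsucc r j (by omega)] at this
    have hcard : ∀ u : Nat.Partition n,
        numParts u = u.parts.count 1 + ∑ k ∈ (range (n + 1)).erase 1, u.parts.count k := by
      intro u
      have h1 := Finset.add_sum_erase (range (n + 1)) (fun k => u.parts.count k) (a := 1)
        (by simp; omega)
      refine Eq.trans ?_ h1.symm
      refine (Multiset.sum_count_eq_card ?_).symm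
      intro k hk
      have := hpn u k hk
      simp; omega
    apply Nat.Partition.ext
    ext k
    by_cases hk : k = 1
    · subst hk
      have h1 := hcard q
      have h2 := hcard r
      rw [Finset.sum_congr rfl fun k hk => hge k (Finset.ne_of_mem_erase hk)] at h1
      omega
    · exact hge k hk
  · rw [Finset.sum_filter]
    refine Eq.trans ?_ h.symm
    apply Finset.sum_congr rfl
    intro q _
    by_cases hq : c q = 0
    · simp [hq]
    · rw [hterm q (hmax q hq)]

/-- Alpha-Omega Lemma, chromatic quasisymmetric version.
If `X_G(x;q)` is symmetric and `c_λ(q) ≠ 0` in its `e`-expansion, then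
`α(G) ≥ λ'_1` and `ω(G) ≤ λ_1`. -/
theorem stmt1 (n N : ℕ) (hN : n ≤ N) (G : SimpleGraph (Fin n))
    (hsym : (chromQSym n N G).IsSymmetric)
    (c : Nat.Partition n → Polynomial ℤ)
    (hc : chromQSym n N G = ∑ p : Nat.Partition n, C (c p) * eProd N (Polynomial ℤ) p)
    (p : Nat.Partition n) (hp : c p ≠ 0) :
    numParts p ≤ indepNum G ∧ cliqueNum G ≤ maxPart p := by
  exact ⟨alpha_part n N hN G c hc p hp, omega_part n N hN G c hc p hp⟩
end

section
/- Let λ be a partition with largest part λ_1 ≤ 2. Then for every natural unit interval graph G, the coefficient c_λ(q) of e_λ in X_G(x;q) is a polynomial in q with nonnegative integer coefficients. -/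
open Finset MvPolynomial
open scoped Classical

/-- Adjacent vertices are consecutive. -/
def PathLike {n : ℕ} (G : SimpleGraph (Fin n)) : Prop :=
  ∀ i j : Fin n, i < j → G.Adj i j → (j : ℕ) = i + 1

/-- Weighted colourings with prescribed colour of the first vertex. -/
noncomputable def WW {n N : ℕ} (z : Fin N → Polynomial (Polynomial ℤ))
    (G : SimpleGraph (Fin (n+1))) (t : Fin N) : Polynomial (Polynomial ℤ) :=
  ∑ κ : Fin n → Fin N, if IsProper G (Fin.cons t κ : Fin (n+1) → Fin N) then
    Polynomial.C (Polynomial.X ^ ascNum G (Fin.cons t κ : Fin (n+1) → Fin N)) *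
      ∏ i, z ((Fin.cons t κ : Fin (n+1) → Fin N) i) else 0

lemma sum_fin_cons {n N : ℕ} {M : Type} [AddCommMonoid M] (f : (Fin (n+1) → Fin N) → M) :
    ∑ κ, f κ = ∑ t : Fin N, ∑ κ : Fin n → Fin N, f (Fin.cons t κ) := by
  rw [← Fintype.sum_prod_type' (f := fun (t : Fin N) (κ : Fin n → Fin N) => f (Fin.cons t κ))]
  exact (Fintype.sum_equiv (Fin.consEquiv (fun _ : Fin (n+1) => Fin N)) _ _ (fun x => rfl)).symm

lemma not_adj_zero {n : ℕ} (G : SimpleGraph (Fin (n+2))) (hG : PathLike G) (j : Fin n) :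
    ¬ G.Adj 0 j.succ.succ := by
  intro h
  have := hG _ _ (Fin.succ_pos _) h
  simp at this

lemma isProper_cons {n N : ℕ} (G : SimpleGraph (Fin (n+2))) (hG : PathLike G) (t : Fin N)
    (κ : Fin (n+1) → Fin N) :
    IsProper G (Fin.cons t κ : Fin (n+2) → Fin N) ↔
      (G.Adj 0 1 → κ 0 ≠ t) ∧ IsProper (G.comap Fin.succ) κ := by
  constructor
  · intro h
    refine ⟨fun h01 => ?_, fun i j hij => ?_⟩
    · have := h 0 1 h01
      rw [← Fin.succ_zero_eq_one] at this
      simpa using this.symm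
    · simpa using h i.succ j.succ hij
  · rintro ⟨h1, h2⟩ i j hij
    have key : ∀ j : Fin (n+1), G.Adj 0 j.succ → κ j ≠ t := by
      intro j hj
      cases j using Fin.cases with
      | zero => exact h1 (by simpa using hj)
      | succ j => exact absurd hj (not_adj_zero G hG j)
    cases i using Fin.cases with
    | zero =>
      cases j using Fin.cases with
      | zero => exact absurd hij (G.irrefl)
      | succ j => simpa using (key j hij).symm
    | succ i =>
      cases j using Fin.cases with
      | zero => simpa using key i hij.symm
      | succ j => simpa using h2 i j hij

lemma ascNum_eq {n N : ℕ} (G : SimpleGraph (Fin n)) (κ : Fin n → Fin N) :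
    ascNum G κ = ∑ i, ∑ j, if G.Adj i j ∧ i < j ∧ κ i < κ j then 1 else 0 := by
  unfold ascNum
  rw [Finset.card_filter, Fintype.sum_prod_type]

lemma ascNum_cons {n N : ℕ} (G : SimpleGraph (Fin (n+2))) (hG : PathLike G) (t : Fin N)
    (κ : Fin (n+1) → Fin N) :
    ascNum G (Fin.cons t κ : Fin (n+2) → Fin N) =
      (if G.Adj 0 1 ∧ t < κ 0 then 1 else 0) + ascNum (G.comap Fin.succ) κ := by
  rw [ascNum_eq, ascNum_eq, Fin.sum_univ_succ]
  congr 1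
  · rw [Fin.sum_univ_succ, Fin.sum_univ_succ]
    simp [not_adj_zero G hG]
  · refine Finset.sum_congr rfl fun i _ => ?_
    rw [Fin.sum_univ_succ]
    simp

lemma WW_succ {n N : ℕ} (z : Fin N → Polynomial (Polynomial ℤ))
    (G : SimpleGraph (Fin (n+2))) (hG : PathLike G) (t : Fin N) :
    WW z G t = z t * ∑ s, if G.Adj 0 1 then (if s = t then 0 else
      (if t < s then Polynomial.C Polynomial.X else 1) * WW z (G.comap Fin.succ) s)
      else WW z (G.comap Fin.succ) s := by
  unfold WW
  rw [sum_fin_cons, Finset.mul_sum]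
  refine Finset.sum_congr rfl fun s _ => ?_
  have h2 : ∀ (a : Polynomial (Polynomial ℤ)) (κ : Fin n → Fin N),
    (∏ i, z ((Fin.cons t (Fin.cons s κ : Fin (n+1) → Fin N) : Fin (n+2) → Fin N) i))
      = z t * ∏ i, z ((Fin.cons s κ : Fin (n+1) → Fin N) i) := by
    intro a κ
    rw [Fin.prod_univ_succ]; simp
  simp only [isProper_cons G hG, ascNum_cons G hG, h2 0, Fin.cons_zero]
  by_cases h : G.Adj 0 1
  · by_cases hs : s = t
    · simp [h, hs]
    · simp only [h, hs, Finset.mul_sum, if_true, if_false, true_and, ne_eq, not_false_eq_true,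
        forall_true_left, true_imp_iff]
      refine Finset.sum_congr rfl fun κ _ => ?_
      split_ifs <;> simp [pow_add] <;> ring
  · simp only [h, Finset.mul_sum, if_false, false_and, false_imp_iff, true_and]
    refine Finset.sum_congr rfl fun κ _ => ?_
    split_ifs <;> simp
    ring

/-- specialisation -/
noncomputable def zz (N : ℕ) (i : Fin N) : Polynomial (Polynomial ℤ) :=
  if (i : ℕ) = 0 then Polynomial.X else if (i : ℕ) = 1 then 1 else 0

/-- nonnegative coefficients -/
def NN (r : Polynomial ℤ) : Prop := ∀ m, 0 ≤ r.coeff m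

lemma NN.mul {r s : Polynomial ℤ} (hr : NN r) (hs : NN s) : NN (r * s) := by
  intro m
  rw [Polynomial.coeff_mul]
  exact Finset.sum_nonneg fun x _ => mul_nonneg (hr _) (hs _)

lemma NN.add {r s : Polynomial ℤ} (hr : NN r) (hs : NN s) : NN (r + s) := by
  intro m
  rw [Polynomial.coeff_add]
  exact add_nonneg (hr _) (hs _)

lemma NN_one : NN 1 := by
  intro m; rw [Polynomial.coeff_one]; split_ifs <;> simp

lemma NN_X : NN Polynomial.X := by
  intro m; rw [Polynomial.coeff_X]; split_ifs <;> simp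

lemma sum_two {M : ℕ} {A : Type} [AddCommMonoid A] (f : Fin (M+2) → A)
    (h : ∀ i : Fin M, f i.succ.succ = 0) : ∑ i, f i = f 0 + f 1 := by
  rw [Fin.sum_univ_succ, Fin.sum_univ_succ]; simp [h]

lemma zz0 (M : ℕ) : zz (M+2) 0 = Polynomial.X := by simp [zz]
lemma zz1 (M : ℕ) : zz (M+2) 1 = 1 := by simp [zz]
lemma zzs (M : ℕ) (i : Fin M) : zz (M+2) i.succ.succ = 0 := by simp [zz]

lemma WW_zero_of (n M : ℕ) (G : SimpleGraph (Fin (n+1))) (i : Fin M) :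
    WW (zz (M+2)) G i.succ.succ = 0 := by
  unfold WW
  refine Finset.sum_eq_zero fun κ _ => ?_
  rw [Fin.prod_univ_succ]
  simp [zzs]

lemma pathLike_comap {n : ℕ} (G : SimpleGraph (Fin (n+1))) (hG : PathLike G) :
    PathLike (G.comap Fin.succ) := by
  intro i j hij h
  have := hG i.succ j.succ (by simpa using hij) h
  simp at this
  omega

lemma WW_form (n M : ℕ) : ∀ (G : SimpleGraph (Fin (n+1))), PathLike G →
    ∃ (r : Polynomial ℤ) (a b : ℕ), NN r ∧
      ((2 * a + b = n ∧
        WW (zz (M+2)) G 0 = Polynomial.C r * (1 + Polynomial.X) ^ b * Polynomial.X ^ a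
          * Polynomial.X ∧
        WW (zz (M+2)) G 1 = Polynomial.C r * (1 + Polynomial.X) ^ b * Polynomial.X ^ a) ∨
       (2 * a + b = n + 1 ∧
        WW (zz (M+2)) G 0 = Polynomial.C r * (1 + Polynomial.X) ^ b * Polynomial.X ^ a
          * Polynomial.C Polynomial.X ∧
        WW (zz (M+2)) G 1 = Polynomial.C r * (1 + Polynomial.X) ^ b * Polynomial.X ^ a)) := by
  induction n with
  | zero =>
    intro G _
    refine ⟨1, 0, 0, NN_one, Or.inl ⟨rfl, ?_, ?_⟩⟩ <;>
    · unfold WW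
      have h1 : ∀ κ : Fin 1 → Fin (M+2), IsProper G κ := by
        intro κ i j hij
        rw [show i = j from Fin.ext (by omega)] at hij
        exact absurd hij G.irrefl
      have h2 : ∀ κ : Fin 1 → Fin (M+2), ascNum G κ = 0 := by
        intro κ
        rw [ascNum_eq]; simp
      simp [h1, h2, zz0, zz1]
  | succ n ih =>
    intro G hG
    obtain ⟨r, a, b, hr, h⟩ := ih _ (pathLike_comap G hG)
    have e0 := WW_succ (zz (M+2)) G hG 0
    have e1 := WW_succ (zz (M+2)) G hG 1
    rw [sum_two _ (by intro i; simp [WW_zero_of])] at e0 e1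
    rw [zz0] at e0
    rw [zz1] at e1
    by_cases hadj : G.Adj 0 1
    · simp [hadj] at e0 e1
      rcases h with ⟨hab, h0, h1⟩ | ⟨hab, h0, h1⟩
      · refine ⟨r, a + 1, b, hr, Or.inr ⟨by omega, ?_, ?_⟩⟩
        · rw [e0, h1]; ring
        · rw [e1, h0]; ring
      · refine ⟨r * Polynomial.X, a, b, hr.mul NN_X, Or.inl ⟨by omega, ?_, ?_⟩⟩
        · rw [e0, h1, Polynomial.C_mul]; ring
        · rw [e1, h0, Polynomial.C_mul]; ring
    · simp [hadj] at e0 e1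
      rcases h with ⟨hab, h0, h1⟩ | ⟨hab, h0, h1⟩
      · refine ⟨r, a, b + 1, hr, Or.inl ⟨by omega, ?_, ?_⟩⟩
        · rw [e0, h0, h1]; ring
        · rw [e1, h0, h1]; ring
      · refine ⟨r * (1 + Polynomial.X), a, b, hr.mul (NN_one.add NN_X),
          Or.inl ⟨by omega, ?_, ?_⟩⟩
        · rw [e0, h0, h1, Polynomial.C_mul, Polynomial.C_add, Polynomial.C_1]; ring
        · rw [e1, h0, h1, Polynomial.C_mul, Polynomial.C_add, Polynomial.C_1]; ring

/-- the specialisation homomorphism -/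
noncomputable def phi (N : ℕ) :
    MvPolynomial (Fin N) (Polynomial ℤ) →+* Polynomial (Polynomial ℤ) :=
  eval₂Hom Polynomial.C (zz N)

lemma phi_chrom (n N : ℕ) (G : SimpleGraph (Fin n)) :
    phi N (chromQSym n N G) = ∑ κ : Fin n → Fin N, if IsProper G κ then
      Polynomial.C (Polynomial.X ^ ascNum G κ) * ∏ i, zz N (κ i) else 0 := by
  unfold chromQSym phi
  rw [map_sum]
  refine Finset.sum_congr rfl fun κ _ => ?_
  split_ifs
  · rw [map_mul, map_prod]
    simp
  · simp

lemma phi_form (n M : ℕ) (G : SimpleGraph (Fin (n+1))) (hG : IsNUIG G) :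
    ∃ (r : Polynomial ℤ) (a b : ℕ), NN r ∧ 2 * a + b = n + 1 ∧
      phi (M+2) (chromQSym (n+1) (M+2) G) =
        Polynomial.C r * ((1 + Polynomial.X) ^ b * Polynomial.X ^ a) := by
  rw [phi_chrom]
  by_cases hP : PathLike G
  · rw [sum_fin_cons]
    change ∃ (r : Polynomial ℤ) (a b : ℕ), NN r ∧ 2 * a + b = n + 1 ∧
      (∑ t, WW (zz (M+2)) G t) = _
    rw [sum_two _ (fun i => WW_zero_of n M G i)]
    obtain ⟨r, a, b, hr, ⟨hab, h0, h1⟩ | ⟨hab, h0, h1⟩⟩ := WW_form n M G hP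
    · refine ⟨r, a, b + 1, hr, by omega, ?_⟩
      rw [h0, h1]; ring
    · refine ⟨r * (1 + Polynomial.X), a, b, hr.mul (NN_one.add NN_X), by omega, ?_⟩
      rw [h0, h1, Polynomial.C_mul, Polynomial.C_add, Polynomial.C_1]; ring
  · refine ⟨0, 0, n + 1, fun m => by simp, by omega, ?_⟩
    simp only [Polynomial.C_0, zero_mul]
    refine Finset.sum_eq_zero fun κ _ => ?_
    split_ifs with hκ
    · unfold PathLike at hP
      push Not at hP
      obtain ⟨i, k, hik, hadj, hne⟩ := hP
      have hik' : (i : ℕ) < k := hik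
      let j : Fin (n+1) := ⟨i + 1, by omega⟩
      have hij : i < j := by simp [j, Fin.lt_def]
      have hjk : j < k := by simp only [j, Fin.lt_def]; omega
      obtain ⟨a1, a2⟩ := hG i j k hij hjk hadj
      have b1 := hκ _ _ a1
      have b2 := hκ _ _ a2
      have b3 := hκ _ _ hadj
      have key : ∃ v, zz (M+2) (κ v) = 0 := by
        by_contra hcon
        push Not at hcon
        have hlt : ∀ v, (κ v : ℕ) < 2 := by
          intro v
          by_contra h
          apply hcon v
          unfold zz
          rw [if_neg (by omega), if_neg (by omega)]
        have := hlt i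
        have := hlt j
        have := hlt k
        rw [ne_eq, Fin.ext_iff] at b1 b2 b3
        omega
      obtain ⟨v, hv⟩ := key
      rw [Finset.prod_eq_zero (Finset.mem_univ v) hv, mul_zero]
    · rfl

lemma phi_esymm (M k : ℕ) : phi (M+2) (esymm (Fin (M+2)) (Polynomial ℤ) k) =
    if k = 0 then 1 else if k = 1 then 1 + Polynomial.X else if k = 2 then Polynomial.X else 0 := by
  have h : phi (M+2) (esymm (Fin (M+2)) (Polynomial ℤ) k) =
      ∑ t ∈ powersetCard k univ, ∏ i ∈ t, zz (M+2) i := by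
    unfold esymm phi
    rw [map_sum]
    refine Finset.sum_congr rfl fun t _ => ?_
    rw [map_prod]; simp
  have hz : ∀ t : Finset (Fin (M+2)), ¬ t ⊆ {0, 1} → ∏ i ∈ t, zz (M+2) i = 0 := by
    intro t ht
    obtain ⟨i, hi, hi2⟩ := Finset.not_subset.mp ht
    refine Finset.prod_eq_zero hi ?_
    unfold zz
    rw [if_neg, if_neg]
    · intro h1
      exact hi2 (by rw [show i = 1 from Fin.ext (by simpa using h1)]; simp)
    · intro h1
      exact hi2 (by rw [show i = 0 from Fin.ext (by simpa using h1)]; simp)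
  rw [h]
  split_ifs with h0 h1 h2
  · subst h0; simp
  · subst h1
    rw [Finset.powersetCard_one]
    simp only [Finset.sum_map, Function.Embedding.coeFn_mk, Finset.prod_singleton]
    rw [sum_two _ (zzs M), zz0, zz1, add_comm]
  · subst h2
    rw [Finset.sum_eq_single {0, 1}]
    · rw [Finset.prod_pair (by simp), zz0, zz1, mul_one]
    · intro t ht hne
      apply hz
      intro hsub
      apply hne
      apply Finset.eq_of_subset_of_card_le hsub
      rw [(Finset.mem_powersetCard.mp ht).2]
      exact Finset.card_le_two
    · intro hn
      exfalso; apply hn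
      rw [Finset.mem_powersetCard]
      exact ⟨Finset.subset_univ _, Finset.card_pair (by simp)⟩
  · refine Finset.sum_eq_zero fun t ht => hz t fun hsub => ?_
    have := Finset.card_le_card hsub
    rw [(Finset.mem_powersetCard.mp ht).2] at this
    have : #({0, 1} : Finset (Fin (M+2))) ≤ 2 := Finset.card_le_two
    omega

lemma phi_big {n : ℕ} (M : ℕ) (p : Nat.Partition n) (hp : ¬ ∀ k ∈ p.parts, k ≤ 2) :
    phi (M+2) (eProd (M+2) (Polynomial ℤ) p) = 0 := by
  push Not at hp
  obtain ⟨k, hk, hk2⟩ := hp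
  unfold eProd
  rw [map_multiset_prod]
  apply Multiset.prod_eq_zero
  simp only [Multiset.map_map, Multiset.mem_map]
  refine ⟨k, hk, ?_⟩
  simp only [Function.comp_apply]
  rw [phi_esymm, if_neg (by omega), if_neg (by omega), if_neg (by omega)]

lemma parts_form {n : ℕ} (p : Nat.Partition n) (hp : ∀ k ∈ p.parts, k ≤ 2) :
    ∃ a b, 2 * a + b = n ∧ p.parts = Multiset.replicate a 2 + Multiset.replicate b 1 := by
  have h : p.parts = Multiset.replicate (p.parts.count 2) 2 +
      Multiset.replicate (p.parts.count 1) 1 := by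
    ext k
    simp only [Multiset.count_add, Multiset.count_replicate]
    by_cases h2 : k = 2
    · subst h2; simp
    by_cases h1 : k = 1
    · subst h1; simp
    rw [if_neg (fun h => h2 h.symm), if_neg (fun h => h1 h.symm)]
    rw [Multiset.count_eq_zero]
    intro hk
    have := hp k hk
    have := p.parts_pos hk
    omega
  refine ⟨_, _, ?_, h⟩
  have hs := p.parts_sum
  rw [h] at hs
  simp at hs
  omega

lemma phi_parts {n : ℕ} (M a b : ℕ) (p : Nat.Partition n)
    (hp : p.parts = Multiset.replicate a 2 + Multiset.replicate b 1) :
    phi (M+2) (eProd (M+2) (Polynomial ℤ) p) = (1 + Polynomial.X) ^ b * Polynomial.X ^ a := by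
  unfold eProd
  rw [map_multiset_prod, hp]
  simp [phi_esymm, mul_comm, -esymm_one]

lemma lin_indep {n : ℕ} (M : ℕ) (d : Nat.Partition n → Polynomial ℤ)
    (hd : ∑ q, Polynomial.C (d q) * phi (M+2) (eProd (M+2) (Polynomial ℤ) q) = 0) :
    ∀ a b (p : Nat.Partition n),
      p.parts = Multiset.replicate a 2 + Multiset.replicate b 1 → d p = 0 := by
  intro a
  induction a using Nat.strong_induction_on with
  | _ a ih =>
    intro b p hp
    have h := congrArg (fun f => Polynomial.coeff f a) hd
    simp only [Polynomial.finsetSum_coeff, Polynomial.coeff_C_mul, Polynomial.coeff_zero] at h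
    rw [Finset.sum_eq_single p] at h
    · rw [phi_parts M a b p hp, Polynomial.coeff_mul_X_pow'] at h
      simpa [Polynomial.coeff_zero_eq_eval_zero] using h
    · intro q _ hqp
      by_cases hq : ∀ k ∈ q.parts, k ≤ 2
      · obtain ⟨a', b', hab, hq'⟩ := parts_form q hq
        rcases lt_trichotomy a' a with hlt | heq | hgt
        · rw [ih a' hlt b' q hq', zero_mul]
        · exfalso; apply hqp
          have hs := p.parts_sum
          rw [hp] at hs
          simp at hs
          ext1
          rw [hp, hq', heq, show b' = b by omega]
        · rw [phi_parts M a' b' q hq', Polynomial.coeff_mul_X_pow', if_neg (by omega), mul_zero]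
      · rw [phi_big M q hq]; simp
    · simp

/-- if `λ_1 ≤ 2` then for every natural unit interval graph `G`
the coefficient `c_λ(q)` of `e_λ` in `X_G(x;q)` has nonnegative coefficients. -/
theorem stmt2 (n N : ℕ) (hN : n ≤ N) (p : Nat.Partition n) (hp : maxPart p ≤ 2)
    (G : SimpleGraph (Fin n)) (hG : IsNUIG G)
    (c : Nat.Partition n → Polynomial ℤ)
    (hc : chromQSym n N G = ∑ q : Nat.Partition n, C (c q) * eProd N (Polynomial ℤ) q) :
    ∀ m, 0 ≤ (c p).coeff m := by
  rcases n with _ | n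
  · have hs : (∑ q : Nat.Partition 0, C (c q) * eProd N (Polynomial ℤ) q) = C (c p) := by
      rw [Fintype.sum_subsingleton _ p]
      have : p.parts = 0 := by
        rw [Subsingleton.elim p default]; rfl
      simp [eProd, this]
    have hl : chromQSym 0 N G = C 1 := by
      unfold chromQSym
      rw [Fintype.sum_unique, if_pos, ascNum_eq]
      · simp
      · intro i
        exact i.elim0
    rw [hs, hl] at hc
    rw [← C_injective _ _ hc]
    exact NN_one
  by_cases hN1 : N < 2
  · obtain rfl : N = 1 := by omega
    obtain rfl : n = 0 := by omega
    have hs : (∑ q : Nat.Partition (0+1), C (c q) * eProd 1 (Polynomial ℤ) q) = C (c p) * X 0 := by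
      have : Subsingleton (Nat.Partition (0+1)) := inferInstanceAs (Subsingleton (Nat.Partition 1))
      rw [Fintype.sum_subsingleton _ p]
      have : p.parts = {1} := by
        rw [Subsingleton.elim p (Nat.Partition.indiscrete 1)]; simp
      simp [eProd, this]
    have hl : chromQSym (0+1) 1 G = C 1 * X 0 := by
      unfold chromQSym
      rw [Fintype.sum_unique, if_pos, ascNum_eq]
      · simp
      · intro i j hij
        rw [show i = j from Fin.ext (by omega)] at hij
        exact absurd hij G.irrefl
    rw [hs, hl] at hc
    have h := congrArg (eval (fun _ => (1 : Polynomial ℤ))) hc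
    simp at h
    rw [← h]
    exact NN_one
  obtain ⟨M, rfl⟩ : ∃ M, N = M + 2 := ⟨N - 2, by omega⟩
  obtain ⟨r, a, b, hr, hab, hF⟩ := phi_form n M G hG
  let q0 : Nat.Partition (n+1) :=
    { parts := Multiset.replicate a 2 + Multiset.replicate b 1
      parts_pos := by
        intro i hi
        rw [Multiset.mem_add] at hi
        rcases hi with hi | hi <;> rw [Multiset.eq_of_mem_replicate hi] <;> norm_num
      parts_sum := by simp; omega }
  have hple : ∀ k ∈ p.parts, k ≤ 2 := fun k hk => (Multiset.le_sup hk).trans hp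
  obtain ⟨a', b', _, hp'⟩ := parts_form p hple
  have hd := lin_indep (n := n+1) M (fun q => c q - if q = q0 then r else 0) (by
    have h := congrArg (phi (M+2)) hc
    rw [hF, map_sum] at h
    simp only [Polynomial.C_sub, sub_mul, Finset.sum_sub_distrib]
    rw [Finset.sum_eq_single (a := q0)
      (f := fun q => Polynomial.C (if q = q0 then r else 0) * _)]
    · rw [if_pos rfl, phi_parts M a b q0 rfl, h, sub_eq_zero]
      refine Finset.sum_congr rfl fun q _ => ?_
      rw [map_mul]
      simp [phi]
    · intro q _ hq
      simp [hq]
    · simp) a' b' p hp'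
  rw [sub_eq_zero.mp hd]
  intro m
  split_ifs
  · exact hr m
  · simp
end

section
/- Let λ be a partition with largest part λ_1 ≤ 3. Then for every natural unit interval graph G, the coefficient c_λ of e_λ in X_G(x) is nonnegative. -/
open Finset MvPolynomial
open scoped Classical
noncomputable section

/-- The generators of the cone of vectors. -/
def vv {R : Type} [CommRing R] (x : Fin 3 → R) (m : ℕ) : Fin 3 → R :=
  match m with
  | 0 => fun _ => 1
  | 1 => fun b => x (b+1) + x (b+2)
  | 2 => fun b => x (b+1) * (x (b+2) + x b) + x (b+2) * (x b + x (b+1))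
  | 3 => fun b => x (b+1) * x (b+2)
  | 4 => fun b => x (b+1) * x (b+2) * (x (b+2) * x b + x b * x (b+1))
  | _ => fun b => x (b+1) * x (b+2) *
      (x (b+2) * x b * (x b * x (b+1) + x (b+1) * x (b+2)) +
       x b * x (b+1) * (x (b+1) * x (b+2) + x (b+2) * x b))

/-- The cone of vectors over a subsemiring. -/
def VV {R : Type} [CommRing R] (x : Fin 3 → R) (S : Subsemiring R) (f : Fin 3 → R) : Prop :=
  ∃ a0 ∈ S, ∃ a1 ∈ S, ∃ a2 ∈ S, ∃ a3 ∈ S, ∃ a4 ∈ S, ∃ a5 ∈ S, ∀ b,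
    f b = a0 * vv x 0 b + a1 * vv x 1 b + a2 * vv x 2 b + a3 * vv x 3 b + a4 * vv x 4 b
      + a5 * vv x 5 b

section cone
variable {R : Type} [CommRing R] (x : Fin 3 → R) (S : Subsemiring R)

theorem VV_const (z : R) (hz : z ∈ S) : VV x S (fun _ => z) :=
  ⟨z, hz, 0, S.zero_mem, 0, S.zero_mem, 0, S.zero_mem, 0, S.zero_mem, 0, S.zero_mem, by
    intro b; simp [vv]⟩

theorem VV_add (f g : Fin 3 → R) (hf : VV x S f) (hg : VV x S g) :
    VV x S (fun b => f b + g b) := by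
  obtain ⟨a0, h0, a1, h1, a2, h2, a3, h3, a4, h4, a5, h5, h⟩ := hf
  obtain ⟨b0, k0, b1, k1, b2, k2, b3, k3, b4, k4, b5, k5, k⟩ := hg
  refine ⟨a0 + b0, S.add_mem h0 k0, a1 + b1, S.add_mem h1 k1, a2 + b2, S.add_mem h2 k2,
    a3 + b3, S.add_mem h3 k3, a4 + b4, S.add_mem h4 k4, a5 + b5, S.add_mem h5 k5, ?_⟩
  intro b
  simp only [h, k]; ring

theorem VV_smul (z : R) (hz : z ∈ S) (f : Fin 3 → R) (hf : VV x S f) :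
    VV x S (fun b => z * f b) := by
  obtain ⟨a0, h0, a1, h1, a2, h2, a3, h3, a4, h4, a5, h5, h⟩ := hf
  refine ⟨z * a0, S.mul_mem hz h0, z * a1, S.mul_mem hz h1, z * a2, S.mul_mem hz h2,
    z * a3, S.mul_mem hz h3, z * a4, S.mul_mem hz h4, z * a5, S.mul_mem hz h5, ?_⟩
  intro b
  simp only [h]; ring

theorem VV_M1
    (he1 : x 0 + x 1 + x 2 ∈ S) (he2 : x 0 * x 1 + x 0 * x 2 + x 1 * x 2 ∈ S)
    (he3 : x 0 * x 1 * x 2 ∈ S) (f : Fin 3 → R) (hf : VV x S f) :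
    VV x S (fun b => x (b+1) * f (b+1) + x (b+2) * f (b+2)) := by
  obtain ⟨a0, h0, a1, h1, a2, h2, a3, h3, a4, h4, a5, h5, h⟩ := hf
  have two : (2 : R) ∈ S := by simp [ofNat_mem]
  set e1 := x 0 + x 1 + x 2 with E1
  set e2 := x 0 * x 1 + x 0 * x 2 + x 1 * x 2 with E2
  set e3 := x 0 * x 1 * x 2 with E3
  refine ⟨2 * e3 * a2 + 2 * e3 * a3 + e3 * e2 * a4 + 2 * e3 * (e1 * e3) * a5, ?_,
    a0 + e2 * a2, ?_, a1, h1, e3 * a4, ?_, e3 * a5, ?_, 0, S.zero_mem, ?_⟩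
  · exact S.add_mem (S.add_mem (S.add_mem (S.mul_mem (S.mul_mem two he3) h2)
      (S.mul_mem (S.mul_mem two he3) h3)) (S.mul_mem (S.mul_mem he3 he2) h4))
      (S.mul_mem (S.mul_mem (S.mul_mem two he3) (S.mul_mem he1 he3)) h5)
  · exact S.add_mem h0 (S.mul_mem he2 h2)
  · exact S.mul_mem he3 h4
  · exact S.mul_mem he3 h5
  · intro b
    simp only [h, vv, E1, E2, E3]
    fin_cases b <;> simp <;> ring

theorem VV_M2
    (he1 : x 0 + x 1 + x 2 ∈ S) (he2 : x 0 * x 1 + x 0 * x 2 + x 1 * x 2 ∈ S)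
    (he3 : x 0 * x 1 * x 2 ∈ S) (f : Fin 3 → R) (hf : VV x S f) :
    VV x S (fun b => x (b+1) * x (b+2) * (f (b+1) + f (b+2))) := by
  obtain ⟨a0, h0, a1, h1, a2, h2, a3, h3, a4, h4, a5, h5, h⟩ := hf
  have two : (2 : R) ∈ S := by simp [ofNat_mem]
  set e1 := x 0 + x 1 + x 2 with E1
  set e2 := x 0 * x 1 + x 0 * x 2 + x 1 * x 2 with E2
  set e3 := x 0 * x 1 * x 2 with E3
  refine ⟨e3 * a1, ?_, e3 * a2, ?_, 0, S.zero_mem,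
    2 * a0 + e1 * a1 + 2 * e2 * a2 + 2 * e3 * e3 * a5, ?_, a3 + e1 * e3 * a5, ?_, a4, h4, ?_⟩
  · exact S.mul_mem he3 h1
  · exact S.mul_mem he3 h2
  · exact S.add_mem (S.add_mem (S.add_mem (S.mul_mem two h0)
      (S.mul_mem he1 h1)) (S.mul_mem (S.mul_mem two he2) h2))
      (S.mul_mem (S.mul_mem (S.mul_mem two he3) he3) h5)
  · exact S.add_mem h3 (S.mul_mem (S.mul_mem he1 he3) h5)
  · intro b
    simp only [h, vv, E1, E2, E3]
    fin_cases b <;> simp <;> ring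

theorem VV_D
    (he1 : x 0 + x 1 + x 2 ∈ S) (he2 : x 0 * x 1 + x 0 * x 2 + x 1 * x 2 ∈ S)
    (he3 : x 0 * x 1 * x 2 ∈ S) (f : Fin 3 → R) (hf : VV x S f) : ∑ c, x c * f c ∈ S := by
  obtain ⟨a0, h0, a1, h1, a2, h2, a3, h3, a4, h4, a5, h5, h⟩ := hf
  have two : (2 : R) ∈ S := by simp [ofNat_mem]
  have three : (3 : R) ∈ S := by simp [ofNat_mem]
  have four : (4 : R) ∈ S := by simp [ofNat_mem]
  set e1 := x 0 + x 1 + x 2 with E1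
  set e2 := x 0 * x 1 + x 0 * x 2 + x 1 * x 2 with E2
  set e3 := x 0 * x 1 * x 2 with E3
  have : ∑ c, x c * f c = e1 * a0 + 2 * e2 * a1 + (e1 * e2 + 3 * e3) * a2 + 3 * e3 * a3
      + 2 * e3 * e2 * a4 + 4 * e3 * e3 * e1 * a5 := by
    simp only [h, vv, E1, E2, E3, Fin.sum_univ_three]
    simp; ring
  rw [this]
  have m := fun (a b : R) (h : a ∈ S) (h' : b ∈ S) => S.mul_mem h h'
  have p := fun (a b : R) (h : a ∈ S) (h' : b ∈ S) => S.add_mem h h'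
  refine p _ _ (p _ _ (p _ _ (p _ _ (p _ _ (m _ _ he1 h0) ?_) ?_) ?_) ?_) ?_
  · exact m _ _ (m _ _ two he2) h1
  · exact m _ _ (p _ _ (m _ _ he1 he2) (m _ _ three he3)) h2
  · exact m _ _ (m _ _ three he3) h3
  · exact m _ _ (m _ _ (m _ _ two he3) he2) h4
  · exact m _ _ (m _ _ (m _ _ (m _ _ four he3) he3) he1) h5
end cone

/-- Weighted sum of the extensions of a partial colouring. -/
def ext3 {R : Type} [CommRing R] (x : Fin 3 → R) : ℕ → (ℕ → ℕ) → Fin 3 → Fin 3 → R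
  | 0, _, _, _ => 1
  | n+1, d, a, b => ∑ c, if (1 ≤ d 0 → c ≠ b) ∧ (2 ≤ d 0 → c ≠ a) then
      x c * ext3 x n (fun i => d (i+1)) b c else 0

theorem ext3_main {R : Type} [CommRing R] (x : Fin 3 → R) (S : Subsemiring R)
    (he1 : x 0 + x 1 + x 2 ∈ S) (he2 : x 0 * x 1 + x 0 * x 2 + x 1 * x 2 ∈ S)
    (he3 : x 0 * x 1 * x 2 ∈ S) (n : ℕ) : ∀ (d : ℕ → ℕ) (_ : ∀ i, d i ≤ 2)
    (_ : ∀ i, d (i+1) ≤ d i + 1),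
    (∃ f0 f1 f2, VV x S f0 ∧ VV x S f1 ∧ VV x S f2 ∧ ∀ a b, a ≠ b →
      ext3 x n d a b = f0 b + x (-(a+b)) * f1 (-(a+b)) + x (-(a+b)) * x a * f2 a) ∧
    (d 0 ≠ 2 → ∃ f, VV x S f ∧ ∀ a b, ext3 x n d a b = f b) ∧
    (d 0 = 0 → ∃ z ∈ S, ∀ a b, ext3 x n d a b = z) := by
  have zV : VV x S (fun _ => 0) := VV_const x S 0 S.zero_mem
  have lift : ∀ (d : ℕ → ℕ), (∃ f, VV x S f ∧ ∀ a b, ext3 x n d a b = f b) →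
    (∃ f0 f1 f2, VV x S f0 ∧ VV x S f1 ∧ VV x S f2 ∧ ∀ a b, a ≠ b →
      ext3 x n d a b = f0 b + x (-(a+b)) * f1 (-(a+b)) + x (-(a+b)) * x a * f2 a) := by
    rintro d ⟨f, hf, h⟩
    exact ⟨f, _, _, hf, zV, zV, fun a b _ => by rw [h]; ring⟩
  cases n with
  | zero =>
    intro d hd hc
    have k : ∃ f, VV x S f ∧ ∀ a b, ext3 x 0 d a b = f b :=
      ⟨fun _ => 1, VV_const x S 1 S.one_mem, fun _ _ => rfl⟩
    exact ⟨lift d k, fun _ => k, fun _ => ⟨1, S.one_mem, fun _ _ => rfl⟩⟩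
  | succ n =>
    intro d hd hc
    obtain ⟨ih1, ih2, ih3⟩ := ext3_main x S he1 he2 he3 n (fun i => d (i+1)) (fun i => hd _)
      (fun i => hc _)
    have h3 : d 0 = 0 ∨ d 0 = 1 ∨ d 0 = 2 := by have := hd 0; omega
    rcases h3 with h | h | h
    · obtain ⟨f, hf, hf'⟩ := ih2 (by have := hc 0; simp at this ⊢; omega)
      have k : ∃ z ∈ S, ∀ a b, ext3 x (n+1) d a b = z :=
        ⟨_, VV_D x S he1 he2 he3 f hf, fun a b => by simp [ext3, h, hf']⟩
      have k2 : ∃ f, VV x S f ∧ ∀ a b, ext3 x (n+1) d a b = f b := by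
        obtain ⟨z, hz, hz'⟩ := k
        exact ⟨_, VV_const x S z hz, hz'⟩
      exact ⟨lift d k2, fun _ => k2, fun _ => k⟩
    · obtain ⟨f0, f1, f2, h0, h1, h2, hf⟩ := ih1
      have k2 : ∃ f, VV x S f ∧ ∀ a b, ext3 x (n+1) d a b = f b := by
        refine ⟨_, VV_add x S _ _ (VV_add x S _ _ (VV_M1 x S he1 he2 he3 f0 h0)
          (VV_M2 x S he1 he2 he3 f1 h1)) (VV_smul x S _ (S.add_mem he3 he3) f2 h2), ?_⟩
        intro a b
        have hf' : ∀ a b, a ≠ b → ext3 x n (fun i => d (i+1)) a b = _ := hf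
        simp only [ext3, h, Fin.sum_univ_three]
        fin_cases b <;> simp [hf', show (-1 : Fin 3) = 2 from rfl, show (-2 : Fin 3) = 1 from rfl,
          show (1 + 2 : Fin 3) = 0 from rfl, show (2 + 1 : Fin 3) = 0 from rfl,
          show (1 + 1 : Fin 3) = 2 from rfl, show (2 + 2 : Fin 3) = 1 from rfl] <;> ring
      exact ⟨lift d k2, fun _ => k2, fun h' => by omega⟩
    · obtain ⟨f0, f1, f2, h0, h1, h2, hf⟩ := ih1
      refine ⟨⟨_, f0, f1, VV_smul x S _ he3 f2 h2, h0, h1, ?_⟩, fun h' => by omega,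
        fun h' => by omega⟩
      have hf' : ∀ a b, a ≠ b → ext3 x n (fun i => d (i+1)) a b = _ := hf
      intro a b hab
      simp only [ext3, h, Fin.sum_univ_three]
      fin_cases a <;> fin_cases b <;> first
        | exact absurd rfl hab
        | (simp [hf', show (-1 : Fin 3) = 2 from rfl, show (-2 : Fin 3) = 1 from rfl,
            show (1 + 2 : Fin 3) = 0 from rfl, show (2 + 1 : Fin 3) = 0 from rfl,
            show (1 + 1 : Fin 3) = 2 from rfl, show (2 + 2 : Fin 3) = 1 from rfl]; ring)

theorem ext3_eq {R : Type} [CommRing R] (x : Fin 3 → R) (n : ℕ) : ∀ (d : ℕ → ℕ) (a b : Fin 3),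
    ext3 x n d a b = ∑ κ : Fin n → Fin 3, if (∀ i : Fin n,
      (1 ≤ d i → κ i ≠ (Fin.cons b κ : Fin (n+1) → Fin 3) i.castSucc) ∧
      (2 ≤ d i → κ i ≠ (Fin.cons a (Fin.cons b κ : Fin (n+1) → Fin 3) : Fin (n+2) → Fin 3)
        i.castSucc.castSucc)) then ∏ i, x (κ i) else 0 := by
  induction n with
  | zero => intro d a b; simp [ext3]
  | succ n ih =>
    intro d a b
    rw [← (Fin.consEquiv (fun _ : Fin (n+1) => Fin 3)).sum_comp, Fintype.sum_prod_type]
    simp only [ext3]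
    refine Finset.sum_congr rfl fun c _ => ?_
    rw [ih]
    by_cases h : (1 ≤ d 0 → c ≠ b) ∧ (2 ≤ d 0 → c ≠ a)
    · rw [if_pos h, Finset.mul_sum]
      refine Finset.sum_congr rfl fun κ _ => ?_
      rw [mul_ite, mul_zero]
      simp only [Fin.consEquiv_apply, Fin.forall_fin_succ (n := n), Fin.prod_univ_succ]
      simp only [Fin.cons_zero, Fin.cons_succ, Fin.val_zero, Fin.val_succ, Fin.castSucc_zero,
        ← Fin.succ_castSucc]
      exact if_congr (and_iff_right h).symm rfl rfl
    · rw [if_neg h]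
      symm
      refine Finset.sum_eq_zero fun κ _ => if_neg ?_
      intro hh
      apply h
      simpa using hh 0

theorem col_sum_change {R : Type} [CommRing R] {n k N : ℕ} (G : SimpleGraph (Fin n))
    (ι : Fin k → Fin N) (hι : Function.Injective ι) (y : Fin N → R)
    (hy : ∀ i, i ∉ Set.range ι → y i = 0) :
    (∑ κ : Fin n → Fin N, if IsProper G κ then ∏ i, y (κ i) else 0) =
    ∑ κ : Fin n → Fin k, if IsProper G κ then ∏ i, y (ι (κ i)) else 0 := by
  symm
  have hinj : Function.Injective (fun κ : Fin n → Fin k => ι ∘ κ) := hι.comp_left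
  refine Finset.sum_of_injOn (fun κ => ι ∘ κ) hinj.injOn (by simp) ?_ ?_
  · intro κ _ hκ
    have : ∃ i, κ i ∉ Set.range ι := by
      by_contra! hc
      choose f hf using hc
      exact hκ ⟨f, by simp, funext hf⟩
    obtain ⟨i, hi⟩ := this
    rw [Finset.prod_eq_zero (Finset.mem_univ i) (hy _ hi), ite_self]
  · intro κ _
    refine if_congr ?_ rfl rfl
    simp only [IsProper, Function.comp, hι.ne_iff]

theorem esymm_change {R : Type} [CommRing R] {k N : ℕ} 
    (ι : Fin k → Fin N) (hι : Function.Injective ι) (y : Fin N → R)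
    (hy : ∀ i, i ∉ Set.range ι → y i = 0) (j : ℕ) :
    ∑ t ∈ powersetCard j (univ : Finset (Fin N)), ∏ i ∈ t, y i =
    ∑ t ∈ powersetCard j (univ : Finset (Fin k)), ∏ i ∈ t, y (ι i) := by
  symm
  refine Finset.sum_of_injOn (fun t => t.map ⟨ι, hι⟩) (Finset.map_injective _).injOn ?_ ?_ ?_
  · intro t ht
    simpa using ht
  · intro t ht hκ
    have : ∃ i ∈ t, i ∉ Set.range ι := by
      by_contra! hc
      apply hκ
      refine ⟨t.preimage ι hι.injOn, ?_, ?_⟩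
      · simp only [Finset.mem_coe, mem_powersetCard, subset_univ, true_and] at ht ⊢
        rw [Finset.card_preimage, ← ht]
        congr 1
        exact Finset.filter_true_of_mem hc
      · simp only [Finset.map_eq_image, Function.Embedding.coeFn_mk]
        rw [Finset.image_preimage]
        exact Finset.filter_true_of_mem hc
    obtain ⟨i, hi, hi'⟩ := this
    exact Finset.prod_eq_zero hi (hy _ hi')
  · intro t _
    simp

theorem graph_main {R : Type} [CommRing R] (x : Fin 3 → R) (S : Subsemiring R)
    (he1 : x 0 + x 1 + x 2 ∈ S) (he2 : x 0 * x 1 + x 0 * x 2 + x 1 * x 2 ∈ S)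
    (he3 : x 0 * x 1 * x 2 ∈ S) (n : ℕ) (G : SimpleGraph (Fin n)) (hG : IsNUIG G) :
    (∑ κ : Fin n → Fin 3, if IsProper G κ then ∏ i, x (κ i) else 0) ∈ S := by
  let A : ℕ → ℕ → Prop := fun i j => ∃ (hi : i < n) (hj : j < n), G.Adj ⟨i, hi⟩ ⟨j, hj⟩
  have hA : ∀ i j k, i < j → j < k → A i k → A i j ∧ A j k := by
    rintro i j k hij hjk ⟨hi, hk, h⟩
    have := hG ⟨i, hi⟩ ⟨j, by omega⟩ ⟨k, hk⟩ hij hjk h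
    exact ⟨⟨_, _, this.1⟩, ⟨_, _, this.2⟩⟩
  by_cases h4 : ∃ i, A i (i+3)
  · obtain ⟨i, h03⟩ := h4
    obtain ⟨h01, h13⟩ := hA i (i+1) (i+3) (by omega) (by omega) h03
    obtain ⟨h02, h23⟩ := hA i (i+2) (i+3) (by omega) (by omega) h03
    obtain ⟨_, h12⟩ := hA i (i+1) (i+2) (by omega) (by omega) h02
    obtain ⟨_, _, h03⟩ := h03
    obtain ⟨_, _, h01⟩ := h01
    obtain ⟨_, _, h13⟩ := h13
    obtain ⟨_, _, h02⟩ := h02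
    obtain ⟨_, _, h23⟩ := h23
    obtain ⟨_, _, h12⟩ := h12
    rw [Finset.sum_eq_zero]
    · exact S.zero_mem
    · intro κ _
      refine if_neg fun hκ => ?_
      have a1 := hκ _ _ h03
      have a2 := hκ _ _ h01
      have a3 := hκ _ _ h02
      have a4 := hκ _ _ h13
      have a5 := hκ _ _ h23
      have a6 := hκ _ _ h12
      omega
  have hfar : ∀ i j, i < j → A i j → j = i + 1 ∨ j = i + 2 := by
    intro i j hij h
    by_contra hc
    rcases Nat.lt_or_ge (i+3) j with h5 | h5
    · exact h4 ⟨i, (hA i (i+3) j (by omega) h5 h).1⟩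
    · have : j = i + 3 := by omega
      subst this
      exact h4 ⟨i, h⟩
  let d : ℕ → ℕ := fun j => if 2 ≤ j ∧ A (j-2) j then 2 else if 1 ≤ j ∧ A (j-1) j then 1 else 0
  have d0 : d 0 = 0 := by simp [d]
  have d2 : ∀ i, d i ≤ 2 := by intro i; simp only [d]; split_ifs <;> omega
  have dle : ∀ i, d (i+1) ≤ d i + 1 := by
    intro i
    by_cases h : 2 ≤ i + 1 ∧ A (i+1-2) (i+1)
    · have : A (i-1) i := (hA (i-1) i (i+1) (by omega) (by omega) h.2).1
      have h1 : 1 ≤ i ∧ A (i-1) i := ⟨by omega, this⟩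
      have := d2 (i+1)
      have : 1 ≤ d i := by
        simp only [d, if_pos h1]; split_ifs <;> omega
      omega
    · have : d (i+1) ≤ 1 := by
        simp only [d, if_neg h]; split_ifs <;> omega
      omega
  have t2 : ∀ j, 2 ≤ d j ↔ 2 ≤ j ∧ A (j-2) j := by
    intro j; simp only [d]; split_ifs with h1 h2 <;> simp [h1]
  have t1 : ∀ j, 1 ≤ d j ↔ 1 ≤ j ∧ A (j-1) j := by
    intro j
    simp only [d]; split_ifs with h1 h2
    · have := (hA (j-2) (j-1) j (by omega) (by omega) h1.2).2
      simp [this]; omega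
    · simp [h2]
    · simp [h2]
  obtain ⟨z, hz, hz'⟩ := (ext3_main x S he1 he2 he3 n d d2 dle).2.2 d0
  convert hz
  rw [← hz' 0 0, ext3_eq]
  refine Finset.sum_congr rfl fun κ _ => ?_
  congr 1
  apply propext
  have c1 : ∀ i (hi : i + 1 < n), (Fin.cons 0 κ : Fin (n+1) → Fin 3) (Fin.castSucc ⟨i+1, hi⟩) =
      κ ⟨i, by omega⟩ := fun i hi => rfl
  have c2 : ∀ i (hi : i + 2 < n), (Fin.cons 0 (Fin.cons 0 κ : Fin (n+1) → Fin 3) : Fin (n+2) → Fin 3)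
      (Fin.castSucc (Fin.castSucc ⟨i+2, hi⟩)) =
      κ ⟨i, by omega⟩ := fun i hi => rfl
  constructor
  · intro hκ ⟨j, hj⟩
    constructor
    · intro h
      obtain ⟨h1, h⟩ := (t1 j).1 h
      obtain ⟨i, rfl⟩ : ∃ i, j = i + 1 := ⟨j-1, by omega⟩
      obtain ⟨_, _, h⟩ := h
      rw [c1]
      exact (hκ _ _ h).symm
    · intro h
      obtain ⟨h1, h⟩ := (t2 j).1 h
      obtain ⟨i, rfl⟩ : ∃ i, j = i + 2 := ⟨j-2, by omega⟩
      obtain ⟨_, _, h⟩ := h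
      rw [c2]
      exact (hκ _ _ h).symm
  · intro hκ
    have key : ∀ i j : Fin n, i < j → G.Adj i j → κ i ≠ κ j := by
      rintro ⟨i, hi⟩ ⟨j, hj⟩ hij h
      rcases hfar i j hij ⟨_, _, h⟩ with rfl | rfl
      · have := (hκ ⟨i+1, hj⟩).1 ((t1 _).2 ⟨by simp, _, _, h⟩)
        rw [c1] at this
        exact this.symm
      · have := (hκ ⟨i+2, hj⟩).2 ((t2 _).2 ⟨by simp, _, _, h⟩)
        rw [c2] at this
        exact this.symm
    intro i j h
    rcases lt_trichotomy i j with h1 | h1 | h1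
    · exact key i j h1 h
    · exact absurd h1 h.ne
    · exact (key j i h1 h.symm).symm

/-- The polynomial ring map sending the `i`-th variable to `e_{i+1}`, from `ℕ` coefficients. -/
def thetaN (k : ℕ) : MvPolynomial (Fin k) ℕ →+* MvPolynomial (Fin k) ℤ :=
  (aeval (fun i : Fin k => esymm (Fin k) ℤ (i + 1))).toRingHom.comp (map (Nat.castRingHom ℤ))

theorem esymm_mem_theta (k j : ℕ) : esymm (Fin k) ℤ j ∈ (thetaN k).rangeS := by
  rcases Nat.eq_zero_or_pos j with rfl | hj
  · rw [esymm_zero]; exact Subsemiring.one_mem _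
  rcases Nat.lt_or_ge k j with h | h
  · have : esymm (Fin k) ℤ j = 0 := by
      rw [esymm, Finset.powersetCard_eq_empty.2 (by simpa using h), Finset.sum_empty]
    rw [this]; exact Subsemiring.zero_mem _
  · refine ⟨X ⟨j-1, by omega⟩, ?_⟩
    simp only [thetaN, RingHom.comp_apply, map_X]
    simp [Nat.sub_add_cancel hj]

/-- The variable for `e_j`. -/
def varv (k j : ℕ) : MvPolynomial (Fin k) ℤ :=
  if h : 1 ≤ j ∧ j ≤ k then X ⟨j-1, by omega⟩ else 0

theorem varv_prod_coeff {n k : ℕ} (p q : Nat.Partition n) (hp : ∀ j ∈ p.parts, j ≤ k) :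
    coeff (Finsupp.equivFunOnFinite.symm fun i : Fin k => p.parts.count (i.1+1))
      ((q.parts.map (varv k)).prod) = if q = p then 1 else 0 := by
  by_cases hq : ∀ j ∈ q.parts, j ≤ k
  · have gen : ∀ s : Multiset ℕ, (∀ j ∈ s, 1 ≤ j ∧ j ≤ k) → (s.map (varv k)).prod =
        monomial (Finsupp.equivFunOnFinite.symm fun i : Fin k => s.count (i.1+1)) 1 := by
      intro s
      induction s using Multiset.induction_on with
      | empty =>
        intro _
        rw [Multiset.map_zero, Multiset.prod_zero]
        rw [show (Finsupp.equivFunOnFinite.symm fun i : Fin k => (0 : Multiset ℕ).count (i.1+1)) = 0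
          from by ext; simp]
        rfl
      | cons a s ih =>
        intro h
        have ha := h a (by simp)
        rw [Multiset.map_cons, Multiset.prod_cons, ih (fun j hj => h j (by simp [hj])), varv,
          dif_pos ha, X, monomial_mul, one_mul]
        refine congrArg (fun m => monomial m (1 : ℤ)) ?_
        ext i
        simp only [Finsupp.add_apply, Finsupp.single_apply, Finsupp.equivFunOnFinite_symm_apply_apply,
          Multiset.count_cons, Fin.ext_iff]
        split_ifs <;> omega
    rw [gen q.parts (fun j hj => ⟨q.parts_pos hj, hq j hj⟩), coeff_monomial]
    refine if_congr ⟨fun h => ?_, fun h => by rw [h]⟩ rfl rfl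
    apply Nat.Partition.ext
    ext j
    by_cases hj : 1 ≤ j ∧ j ≤ k
    · have := DFunLike.congr_fun h ⟨j-1, by omega⟩
      simpa [Nat.sub_add_cancel hj.1] using this
    · rw [Multiset.count_eq_zero_of_notMem, Multiset.count_eq_zero_of_notMem]
      · intro h'; exact hj ⟨p.parts_pos h', hp j h'⟩
      · intro h'; exact hj ⟨q.parts_pos h', hq j h'⟩
  · have hne : q ≠ p := by rintro rfl; exact hq hp
    rw [if_neg hne]
    push Not at hq
    obtain ⟨j, hj, hjk⟩ := hq
    rw [Multiset.prod_eq_zero, coeff_zero]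
    rw [Multiset.mem_map]
    exact ⟨j, hj, dif_neg (by omega)⟩

end

/-- if `λ_1 ≤ 3` then for every natural unit interval graph `G`
the coefficient `c_λ` of `e_λ` in `X_G(x)` is nonnegative. -/
theorem stmt3 (n N : ℕ) (hN : n ≤ N) (p : Nat.Partition n) (hp : maxPart p ≤ 3)
    (G : SimpleGraph (Fin n)) (hG : IsNUIG G)
    (c : Nat.Partition n → ℤ)
    (hc : chromSym n N G = ∑ q : Nat.Partition n, C (c q) * eProd N ℤ q) :
    0 ≤ c p := by
  obtain ⟨k, hk⟩ : ∃ k, k = min N 3 := ⟨_, rfl⟩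
  have hkN : k ≤ N := by omega
  have hk3 : k ≤ 3 := by omega
  have hpk : ∀ j ∈ p.parts, j ≤ k := by
    intro j hj
    have h1 : j ≤ 3 := (Multiset.le_sup hj).trans hp
    have h2 : j ≤ n := p.le_of_mem_parts hj
    omega
  -- the variables, padded by zeros
  let y : (M : ℕ) → Fin M → MvPolynomial (Fin k) ℤ :=
    fun M i => if h : i.1 < k then X ⟨i.1, h⟩ else 0
  have hy : ∀ M (hM : k ≤ M) (i : Fin M), i ∉ Set.range (Fin.castLE hM) → y M i = 0 := by
    intro M hM i hi
    refine dif_neg fun h => hi ⟨⟨i.1, h⟩, rfl⟩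
  have hyX : ∀ M (hM : k ≤ M) (i : Fin k), y M (Fin.castLE hM i) = X i := by
    intro M hM i
    exact dif_pos i.2
  have hes : ∀ M (_ : k ≤ M) (j : ℕ),
      ∑ t ∈ powersetCard j (univ : Finset (Fin M)), ∏ i ∈ t, y M i = esymm (Fin k) ℤ j := by
    intro M hM j
    rw [esymm_change (Fin.castLE hM) (Fin.castLE_injective hM) (y M) (hy M hM)]
    simp only [hyX, esymm]
  have hcol : ∀ M (_ : k ≤ M),
      (∑ κ : Fin n → Fin M, if IsProper G κ then ∏ i, y M (κ i) else 0) = chromSym n k G := by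
    intro M hM
    rw [col_sum_change G (Fin.castLE hM) (Fin.castLE_injective hM) (y M) (hy M hM)]
    simp only [hyX, chromSym]
  have hmem : chromSym n k G ∈ (thetaN k).rangeS := by
    rw [← hcol 3 hk3]
    refine graph_main (y 3) _ ?_ ?_ ?_ n G hG
    · convert esymm_mem_theta k 1 using 1
      rw [← hes 3 hk3, show powersetCard 1 (univ : Finset (Fin 3)) = {{0}, {1}, {2}} from by decide,
        Finset.sum_insert (by decide), Finset.sum_insert (by decide)]
      simp [add_assoc]
    · convert esymm_mem_theta k 2 using 1
      rw [← hes 3 hk3,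
        show powersetCard 2 (univ : Finset (Fin 3)) = {{0, 1}, {0, 2}, {1, 2}} from by decide,
        Finset.sum_insert (by decide), Finset.sum_insert (by decide)]
      simp [add_assoc]
    · convert esymm_mem_theta k 3 using 1
      rw [← hes 3 hk3, show powersetCard 3 (univ : Finset (Fin 3)) = {univ} from by decide,
        Finset.sum_singleton, Fin.prod_univ_three]
  have h2 := congrArg (aeval (y N)) hc
  have hL : aeval (y N) (chromSym n N G) = chromSym n k G := by
    rw [← hcol N hkN, chromSym, map_sum]
    refine Finset.sum_congr rfl fun κ _ => ?_
    split_ifs <;> simp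
  obtain ⟨F, hF⟩ := hmem
  have hinj : Function.Injective (aeval (R := ℤ) (fun i : Fin k => esymm (Fin k) ℤ (i + 1))) := by
    intro a b hab
    apply esymmAlgHom_fin_injective ℤ (le_refl k)
    apply Subtype.ext
    rw [← esymmAlgHom_apply, ← esymmAlgHom_apply] at hab
    exact hab
  have hR : aeval (y N) (∑ q : Nat.Partition n, C (c q) * eProd N ℤ q) =
      aeval (fun i : Fin k => esymm (Fin k) ℤ (i + 1))
        (∑ q : Nat.Partition n, C (c q) * (q.parts.map (varv k)).prod) := by
    rw [map_sum, map_sum]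
    refine Finset.sum_congr rfl fun q _ => ?_
    rw [map_mul, map_mul, eProd, map_multiset_prod, map_multiset_prod, Multiset.map_map,
      Multiset.map_map]
    congr 1
    · simp
    congr 1
    refine Multiset.map_congr rfl fun j hj => ?_
    have hj1 : 1 ≤ j := q.parts_pos hj
    have : aeval (y N) (esymm (Fin N) ℤ j) = esymm (Fin k) ℤ j := by
      rw [← hes N hkN]
      simp [esymm]
    simp only [Function.comp_apply, this, varv]
    split_ifs with h
    · simp [Nat.sub_add_cancel hj1]
    · rw [esymm, Finset.powersetCard_eq_empty.2 (by simp; omega), Finset.sum_empty, map_zero]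
  rw [hL, hR, ← hF] at h2
  have h3 := hinj h2
  have h4 := congrArg (coeff (Finsupp.equivFunOnFinite.symm
    fun i : Fin k => p.parts.count (i.1+1))) h3
  simp only [coeff_sum, coeff_C_mul, varv_prod_coeff p _ hpk] at h4
  simp at h4
  rw [← h4]
  exact Int.natCast_nonneg _
end
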